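/- For every t ∈ (0,1], the t-Aluthge transform Δ_t(S_λ) is closable and its closure equals the weighted shift S_μ: the closure of the graph of Δ_t(S_λ) in ℓ²(V) × ℓ²(V) equals the graph of S_μ. -/

import Mathlib

open scoped ENNReal NNReal ComplexConjugate Classical ComplexInnerProductSpace

noncomputable section

/-- `HS V` is the Hilbert space `ℓ²(V)` of square-summable families of complex numbers
indexed by `V`. -/
abbrev HS (V : Type*) : Type _ := lp (fun _ : V => ℂ) 2

/-- A (possibly unbounded) partially defined operator in a Hilbert space `E`: a domain
together with an assignment of values.  Only the restriction of `toFun` to `dom` is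
relevant (e.g. via `POp.graph`). -/
structure POp (E : Type*) [NormedAddCommGroup E] [InnerProductSpace ℂ E] where
  dom : Set E
  toFun : E → E

namespace POp

variable {E : Type*} [NormedAddCommGroup E] [InnerProductSpace ℂ E]

/-- Composition of partially defined operators: `(A.comp B) f = A (B f)` on the natural
domain `{f ∈ dom B : B f ∈ dom A}`. -/
def comp (A B : POp E) : POp E :=
  ⟨{f | f ∈ B.dom ∧ B.toFun f ∈ A.dom}, fun f => A.toFun (B.toFun f)⟩

/-- The graph of a partially defined operator, as a subset of `E × E`. -/
def graph (A : POp E) : Set (E × E) := {p | p.1 ∈ A.dom ∧ p.2 = A.toFun p.1}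

/-- The Hilbert-space adjoint of a (densely defined) partially defined operator `A`:
`g ∈ dom A*` iff there is `h` with `⟪A f, g⟫ = ⟪f, h⟫` for all `f ∈ dom A`, and then
`A* g = h` (`h` is unique when `A` is densely defined). -/
def adj (A : POp E) : POp E :=
  ⟨{g | ∃ h : E, ∀ f ∈ A.dom, ⟪A.toFun f, g⟫ = ⟪f, h⟫},
   fun g => if h : ∃ h' : E, ∀ f ∈ A.dom, ⟪A.toFun f, g⟫ = ⟪f, h'⟫ then h.choose else 0⟩

end POp

variable {V : Type*}

/-- The element of `ℓ²(V)` with coordinates `g` (junk value `0` if `g` is not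
square-summable). -/
def mkH (g : V → ℂ) : HS V := if h : Memℓp g 2 then ⟨g, h⟩ else 0

/-- The standard orthonormal basis vector `e_u` of `ℓ²(V)`. -/
def eV (u : V) : HS V := mkH (fun v => if v = u then 1 else 0)

/-- The weighted shift `S_λ` on the directed tree encoded by the parent map `par`
(with `Chi(u) = {v : par v = u}`), with weights `lam`:
domain `{f : Σ_u (Σ_{v ∈ Chi(u)} |λ v|²)·|f u|² < ∞}` and value
`(S_λ f)(v) = λ v · f (par v)`. -/
def shiftOp (par : V → V) (lam : V → ℂ) : POp (HS V) :=
  ⟨{f | ∑' u : V, ((∑' v : {v : V // par v = u}, ((‖lam v.1‖₊ : ℝ≥0∞) ^ 2)) *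
        (‖f u‖₊ : ℝ≥0∞) ^ 2) < ⊤},
   fun f => mkH (fun v => lam v * f (par v))⟩

/-- `cW par lam u = (Σ_{v ∈ Chi(u)} |λ v|²)^{1/2}`, i.e. `c(u) = ‖S_λ e_u‖`. -/
def cW (par : V → V) (lam : V → ℂ) (u : V) : ℝ :=
  Real.sqrt (∑' v : {v : V // par v = u}, ‖lam v.1‖ ^ 2)

/-- The multiplication operator `M_α` (representing `|S_λ|^α`): domain
`{f : Σ_u c(u)^{2α}·|f u|² < ∞}` and `(M_α f)(u) = c(u)^α·f(u)`. -/
def mulOp (par : V → V) (lam : V → ℂ) (α : ℝ) : POp (HS V) :=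
  ⟨{f | Summable fun u : V => cW par lam u ^ (2 * α) * ‖f u‖ ^ 2},
   fun f => mkH (fun u => ((cW par lam u ^ α : ℝ) : ℂ) * f u)⟩

/-- The weights `π` of the partial isometry in the polar decomposition of `S_λ`:
`π v = λ v / c(par v)` if `c(par v) > 0`, and `π v = 0` otherwise. -/
def piW (par : V → V) (lam : V → ℂ) (v : V) : ℂ :=
  if 0 < cW par lam (par v) then lam v / ((cW par lam (par v) : ℝ) : ℂ) else 0

/-- The partial isometry `S_π` of the polar decomposition of `S_λ`
(a contraction defined on all of `ℓ²(V)`). -/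
def piOp (par : V → V) (lam : V → ℂ) : POp (HS V) :=
  ⟨Set.univ, fun f => mkH (fun v => piW par lam v * f (par v))⟩

/-- The weights `μ`: `μ v = (c v / c (par v))^t · λ v` if `c (par v) > 0`, else `0`. -/
def muW (par : V → V) (lam : V → ℂ) (t : ℝ) (v : V) : ℂ :=
  if 0 < cW par lam (par v)
  then (((cW par lam v / cW par lam (par v)) ^ t : ℝ) : ℂ) * lam v else 0

/-- The `t`-Aluthge transform `Δ_t(S_λ) = M_t ∘ S_π ∘ M_{1-t} = |S_λ|^t S_π |S_λ|^{1-t}`. -/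
def aluthge (par : V → V) (lam : V → ℂ) (t : ℝ) : POp (HS V) :=
  ((mulOp par lam t).comp (piOp par lam)).comp (mulOp par lam (1 - t))

lemma memℓp_two_iff_summable_sq {g : V → ℂ} :
    Memℓp g 2 ↔ Summable fun v => ‖g v‖ ^ 2 := by
  rw [memℓp_gen_iff (by norm_num)]
  simp

lemma memℓp_two_iff_tsum_lt_top {g : V → ℂ} :
    Memℓp g 2 ↔ ∑' v, (‖g v‖₊ : ℝ≥0∞) ^ 2 < ⊤ := by
  have h : ∀ v, (‖g v‖₊ : ℝ≥0∞) ^ 2 = ((‖g v‖₊ ^ 2 : ℝ≥0) : ℝ≥0∞) := fun v => by simp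
  rw [memℓp_two_iff_summable_sq, lt_top_iff_ne_top, tsum_congr h,
    ENNReal.tsum_coe_ne_top_iff_summable, ← NNReal.summable_coe]
  simp

lemma mkH_apply {g : V → ℂ} (h : Memℓp g 2) (v : V) : mkH g v = g v := by
  simp only [mkH, dif_pos h]

lemma eq_mkH_iff {g : V → ℂ} (h : Memℓp g 2) {x : HS V} : x = mkH g ↔ ∀ v, x v = g v := by
  constructor
  · rintro rfl
    exact mkH_apply h
  · intro hx
    ext v
    rw [hx, mkH_apply h]

lemma mem_dom_shiftOp_iff (par : V → V) (w : V → ℂ) (f : HS V) :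
    f ∈ (shiftOp par w).dom ↔ Memℓp (fun v => w v * f (par v)) 2 := by
  rw [memℓp_two_iff_tsum_lt_top]
  have h : ∑' v, (‖w v * f (par v)‖₊ : ℝ≥0∞) ^ 2 =
      ∑' u : V, ((∑' v : {v : V // par v = u}, ((‖w v.1‖₊ : ℝ≥0∞) ^ 2)) *
        (‖f u‖₊ : ℝ≥0∞) ^ 2) := by
    rw [← (Equiv.sigmaFiberEquiv par).tsum_eq, ENNReal.tsum_sigma']
    refine tsum_congr fun u => ?_
    rw [← ENNReal.tsum_mul_right]
    refine tsum_congr fun v => ?_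
    simp [Equiv.sigmaFiberEquiv, v.2, mul_pow]
  rw [h]
  rfl

lemma mem_graph_shiftOp_iff (par : V → V) (w : V → ℂ) (p : HS V × HS V) :
    p ∈ (shiftOp par w).graph ↔ ∀ v, p.2 v = w v * p.1 (par v) := by
  constructor
  · rintro ⟨h, hp⟩
    exact (eq_mkH_iff ((mem_dom_shiftOp_iff par w _).1 h)).1 hp
  · intro hp
    have h : Memℓp (fun v => w v * p.1 (par v)) 2 := by
      rw [← funext hp]
      exact lp.memℓp p.2
    exact ⟨(mem_dom_shiftOp_iff par w _).2 h, (eq_mkH_iff h).2 hp⟩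

lemma isClosed_graph_shiftOp (par : V → V) (w : V → ℂ) : IsClosed (shiftOp par w).graph := by
  have hc : ∀ v, Continuous fun f : HS V => f v := fun v =>
    (continuous_apply v).comp (lp.uniformContinuous_coe (E := fun _ : V => ℂ) (p := 2)).continuous
  have h : (shiftOp par w).graph = ⋂ v, {p | p.2 v = w v * p.1 (par v)} := by
    ext p
    simp [mem_graph_shiftOp_iff]
  rw [h]
  exact isClosed_iInter fun v => isClosed_eq ((hc v).comp continuous_snd)
    (continuous_const.mul ((hc (par v)).comp continuous_fst))

lemma cW_nonneg (par : V → V) (lam : V → ℂ) (u : V) : 0 ≤ cW par lam u := Real.sqrt_nonneg _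

lemma tsum_enorm_piW_le_one {par : V → V} {lam : V → ℂ} {u : V}
    (hl : Summable fun v : {v : V // par v = u} => ‖lam v.1‖ ^ 2) :
    ∑' v : {v : V // par v = u}, (‖piW par lam v.1‖₊ : ℝ≥0∞) ^ 2 ≤ 1 := by
  by_cases hu : 0 < cW par lam u
  · have hsq : cW par lam u ^ 2 = ∑' v : {v : V // par v = u}, ‖lam v.1‖ ^ 2 :=
      Real.sq_sqrt (tsum_nonneg fun v => sq_nonneg _)
    have h : ∀ v : {v : V // par v = u},
        (‖piW par lam v.1‖₊ : ℝ≥0∞) ^ 2 = ENNReal.ofReal (‖lam v.1‖ ^ 2 / cW par lam u ^ 2) := by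
      intro v
      have hv : ‖lam v.1‖ ^ 2 / cW par lam u ^ 2 = ‖piW par lam v.1‖ ^ 2 := by
        simp [piW, v.2, hu, div_pow]
      rw [hv, ENNReal.ofReal_pow (norm_nonneg _), ofReal_norm]
      rfl
    rw [tsum_congr h, ← ENNReal.ofReal_tsum_of_nonneg (fun v => by positivity) (hl.div_const _),
      tsum_div_const, ← hsq, div_self (by positivity)]
    simp
  · have h : ∀ v : {v : V // par v = u}, (‖piW par lam v.1‖₊ : ℝ≥0∞) ^ 2 = 0 := by
      intro v
      simp [piW, v.2, hu]
    simp [tsum_congr h]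

lemma memℓp_piW_mul {par : V → V} {lam : V → ℂ}
    (hl : ∀ u : V, Summable fun v : {v : V // par v = u} => ‖lam v.1‖ ^ 2) (f : HS V) :
    Memℓp (fun v => piW par lam v * f (par v)) 2 := by
  rw [← mem_dom_shiftOp_iff]
  have hf := memℓp_two_iff_tsum_lt_top.1 (lp.memℓp f)
  refine lt_of_le_of_lt (ENNReal.tsum_le_tsum fun u => ?_) hf
  exact mul_le_of_le_one_left' (tsum_enorm_piW_le_one (hl u))

lemma mem_dom_mulOp_iff (par : V → V) (lam : V → ℂ) (α : ℝ) (f : HS V) :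
    f ∈ (mulOp par lam α).dom ↔ Memℓp (fun u => ((cW par lam u ^ α : ℝ) : ℂ) * f u) 2 := by
  rw [memℓp_two_iff_summable_sq]
  refine summable_congr fun u => ?_
  have hc := cW_nonneg par lam u
  rw [norm_mul, Complex.norm_real, Real.norm_of_nonneg (Real.rpow_nonneg hc _), mul_pow,
    ← Real.rpow_mul_natCast hc, Nat.cast_ofNat, mul_comm α]

lemma cW_rpow_mul_piW_mul (par : V → V) (lam : V → ℂ) (t : ℝ) (v : V) :
    ((cW par lam v ^ t : ℝ) : ℂ) *
      (piW par lam v * ((cW par lam (par v) ^ (1 - t) : ℝ) : ℂ)) = muW par lam t v := by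
  by_cases hv : 0 < cW par lam (par v)
  · have hc : ((cW par lam (par v) ^ t : ℝ) : ℂ) ≠ 0 :=
      Complex.ofReal_ne_zero.2 (Real.rpow_pos_of_pos hv t).ne'
    have hc' : ((cW par lam (par v) : ℝ) : ℂ) ≠ 0 := Complex.ofReal_ne_zero.2 hv.ne'
    rw [piW, muW, if_pos hv, if_pos hv, Real.rpow_sub hv, Real.rpow_one,
      Real.div_rpow (cW_nonneg par lam v) hv.le, Complex.ofReal_div, Complex.ofReal_div]
    field_simp
  · simp [piW, muW, hv]

lemma mem_graph_aluthge_iff {par : V → V} {lam : V → ℂ}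
    (hl : ∀ u : V, Summable fun v : {v : V // par v = u} => ‖lam v.1‖ ^ 2) (t : ℝ)
    (p : HS V × HS V) :
    p ∈ (aluthge par lam t).graph ↔
      p.1 ∈ (mulOp par lam (1 - t)).dom ∧ ∀ v, p.2 v = muW par lam t v * p.1 (par v) := by
  have key : p.1 ∈ (mulOp par lam (1 - t)).dom →
      (fun v => ((cW par lam v ^ t : ℝ) : ℂ) *
        (piOp par lam).toFun ((mulOp par lam (1 - t)).toFun p.1) v) =
      fun v => muW par lam t v * p.1 (par v) := by
    intro h
    funext v
    rw [← cW_rpow_mul_piW_mul]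
    simp only [piOp, mulOp]
    rw [mkH_apply (memℓp_piW_mul hl _), mkH_apply ((mem_dom_mulOp_iff _ _ _ _).1 h)]
    ring
  have hdom : p.1 ∈ (aluthge par lam t).dom ↔ p.1 ∈ (mulOp par lam (1 - t)).dom ∧
      (piOp par lam).toFun ((mulOp par lam (1 - t)).toFun p.1) ∈ (mulOp par lam t).dom :=
    ⟨fun h => ⟨h.1, h.2.2⟩, fun h => ⟨h.1, trivial, h.2⟩⟩
  have hval : (aluthge par lam t).toFun p.1 = mkH fun v => ((cW par lam v ^ t : ℝ) : ℂ) *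
      (piOp par lam).toFun ((mulOp par lam (1 - t)).toFun p.1) v := rfl
  change p.1 ∈ (aluthge par lam t).dom ∧ p.2 = (aluthge par lam t).toFun p.1 ↔ _
  rw [hdom, hval, mem_dom_mulOp_iff par lam t, and_assoc]
  refine and_congr_right fun h => ?_
  rw [key h]
  constructor
  · rintro ⟨hm, hp⟩
    exact (eq_mkH_iff hm).1 hp
  · intro hp
    have hm : Memℓp (fun v => muW par lam t v * p.1 (par v)) 2 := by
      rw [← funext hp]
      exact lp.memℓp p.2
    exact ⟨hm, (eq_mkH_iff hm).2 hp⟩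

lemma memℓp_ite_mem (r : V → V) (F : Finset V) (g : HS V) :
    Memℓp (fun v => if r v ∈ F then g v else 0) 2 := by
  rw [memℓp_two_iff_summable_sq]
  refine (memℓp_two_iff_summable_sq.1 (lp.memℓp g)).of_nonneg_of_le
    (fun v => sq_nonneg _) fun v => ?_
  split_ifs <;> simp

lemma tendsto_mkH_ite_mem (r : V → V) (g : HS V) :
    Filter.Tendsto (fun F : Finset V => mkH fun v => if r v ∈ F then g v else 0)
      Filter.atTop (nhds g) := by
  have hg := memℓp_two_iff_summable_sq.1 (lp.memℓp g)
  have hnorm : ∀ x : HS V, ‖x‖ ^ 2 = ∑' v, ‖x v‖ ^ 2 := fun x => by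
    simpa using lp.norm_rpow_eq_tsum (p := 2) (by norm_num) x
  have hlim : Filter.Tendsto (fun F : Finset V =>
      ∑' v, ‖(mkH (fun v => if r v ∈ F then g v else 0) - g) v‖ ^ 2)
      Filter.atTop (nhds (∑' _ : V, (0 : ℝ))) := by
    refine tendsto_tsum_of_dominated_convergence hg (fun v => ?_) (.of_forall fun F v => ?_)
    · refine tendsto_const_nhds.congr' ?_
      filter_upwards [Filter.eventually_ge_atTop {r v}] with F hF
      have hv : r v ∈ F := hF (Finset.mem_singleton_self _)
      simp [mkH_apply (memℓp_ite_mem r F g), hv]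
    · rw [lp.coeFn_sub, Pi.sub_apply, mkH_apply (memℓp_ite_mem r F g)]
      split_ifs <;> simp
  rw [tendsto_iff_norm_sub_tendsto_zero]
  have h := hlim.sqrt
  simp only [← hnorm, tsum_zero, Real.sqrt_zero, Real.sqrt_sq (norm_nonneg _)] at h
  exact h

/-- Theorem 4.1 (ii): for `t ∈ (0,1]`, `Δ_t(S_λ)` is closable and its
closure is the weighted shift `S_μ`: the closure of the graph of `Δ_t(S_λ)` equals the
graph of `S_μ`. -/
theorem statement_5 (V : Type*) [Nonempty V] (par : V → V)
    (ha : ∀ u v : V, ∃ m n : ℕ, par^[m] u = par^[n] v)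
    (hb : ∀ (v : V) (n : ℕ), 1 ≤ n → par^[n] v ≠ v)
    (lam : V → ℂ)
    (hl : ∀ u : V, Summable fun v : {v : V // par v = u} => ‖lam v.1‖ ^ 2)
    (t : ℝ) (ht : t ∈ Set.Ioc (0 : ℝ) 1) :
    closure (POp.graph (aluthge par lam t)) = POp.graph (shiftOp par (muW par lam t)) := by
  refine subset_antisymm (closure_minimal (fun p hp => ?_) (isClosed_graph_shiftOp _ _)) ?_
  · exact (mem_graph_shiftOp_iff _ _ _).2 ((mem_graph_aluthge_iff hl t p).1 hp).2
  · intro p hp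
    rw [mem_graph_shiftOp_iff] at hp
    refine mem_closure_of_tendsto
      ((tendsto_mkH_ite_mem id p.1).prodMk_nhds (tendsto_mkH_ite_mem par p.2))
      (.of_forall fun F => (mem_graph_aluthge_iff hl t _).2 ⟨?_, fun v => ?_⟩)
    · refine summable_of_ne_finset_zero (s := F) fun u hu => ?_
      have h := mkH_apply (memℓp_ite_mem id F p.1) u
      rw [h, id, if_neg hu]
      simp
    · have h := mkH_apply (memℓp_ite_mem id F p.1) (par v)
      simp only [id] at h ⊢
      rw [h, mkH_apply (memℓp_ite_mem par F p.2), hp]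
      split_ifs <;> simp
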